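/- For all words p', r' over {0,1}, the following integer identities hold: C(h(p')·0, 01) − C(h(p')·0, 10) = |p'|_0 + 3·C(p',01) − 3·C(p',10), and C(1·h(r'), 01) − C(1·h(r'), 10) = |r'|_1 + 3·C(r',01) − 3·C(r',10). -/

import Mathlib

/-- Number of occurrences of `v` as a scattered subword (subsequence) of `u`. -/
def binomC {α : Type*} [DecidableEq α] (u v : List α) : ℕ := u.sublists.count v

/-- Two words are 2-binomially equivalent. -/
def binEq2 {α : Type*} [DecidableEq α] (u v : List α) : Prop :=
  ∀ x : List α, x.length ≤ 2 → binomC u x = binomC v x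

/-- The morphism h : 0 ↦ 001, 1 ↦ 011. -/
def h : Fin 2 → List (Fin 2) := ![[0,0,1],[0,1,1]]

/-- Apply the morphism h to a word. -/
def hWord (w : List (Fin 2)) : List (Fin 2) := w.flatMap h

theorem binomC_nil_right {α : Type*} [DecidableEq α] (u : List α) : binomC u [] = 1 := by
  unfold binomC
  rw [(List.sublists_perm_sublists' u).count_eq]
  induction u with
  | nil => simp
  | cons a u ih =>
    rw [List.sublists'_cons, List.count_append, ih, List.count_eq_zero_of_not_mem (by simp)]

theorem binomC_nil_cons {α : Type*} [DecidableEq α] (b : α) (v : List α) :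
    binomC [] (b :: v) = 0 := by
  simp [binomC]

theorem binomC_cons_cons {α : Type*} [DecidableEq α] (a b : α) (u v : List α) :
    binomC (a :: u) (b :: v) = binomC u (b :: v) + if a = b then binomC u v else 0 := by
  unfold binomC
  simp only [(List.sublists_perm_sublists' _).count_eq]
  rw [List.sublists'_cons, List.count_append]
  congr 1
  split_ifs with hab
  · subst hab
    exact List.count_map_of_injective _ _ List.cons_injective _
  · exact List.count_eq_zero_of_not_mem (by simp [hab])

theorem binomC_singleton {α : Type*} [DecidableEq α] (u : List α) (b : α) :
    binomC u [b] = u.count b := by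
  induction u with
  | nil => simp [binomC_nil_cons]
  | cons a u ih => simp [binomC_cons_cons, binomC_nil_right, ih, List.count_cons]

theorem hWord_nil : hWord [] = [] := rfl

theorem hWord_zero_cons (w : List (Fin 2)) : hWord (0 :: w) = 0 :: 0 :: 1 :: hWord w := rfl

theorem hWord_one_cons (w : List (Fin 2)) : hWord (1 :: w) = 0 :: 1 :: 1 :: hWord w := rfl

theorem count_zero_hWord (w : List (Fin 2)) :
    (hWord w).count 0 = 2 * w.count 0 + w.count 1 := by
  induction w with
  | nil => rfl
  | cons a w ih =>
    fin_cases a <;> simp [hWord_zero_cons, hWord_one_cons, ih] <;> ring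

theorem count_one_hWord (w : List (Fin 2)) :
    (hWord w).count 1 = w.count 0 + 2 * w.count 1 := by
  induction w with
  | nil => rfl
  | cons a w ih =>
    fin_cases a <;> simp [hWord_zero_cons, hWord_one_cons, ih] <;> ring

/-- The 01/10 imbalance of h(w)v, in terms of letter counts and the imbalances of w and v. -/
theorem imbalance_hWord_append (w v : List (Fin 2)) :
    (binomC (hWord w ++ v) [0, 1] : ℤ) - binomC (hWord w ++ v) [1, 0] =
      3 * binomC w [0, 1] - 3 * binomC w [1, 0] + 2 * w.count 0 + 2 * w.count 1 -
        w.count 0 * v.count 0 + 2 * w.count 0 * v.count 1 -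
        2 * w.count 1 * v.count 0 + w.count 1 * v.count 1 +
        binomC v [0, 1] - binomC v [1, 0] := by
  induction w with
  | nil => simp [hWord_nil, binomC_nil_cons]
  | cons a w ih =>
    fin_cases a <;>
      simp [hWord_zero_cons, hWord_one_cons, binomC_cons_cons, binomC_singleton,
        count_zero_hWord, count_one_hWord] <;> linarith

/-- The 01/10 imbalance of h(p')0 and of 1h(r'). -/
theorem imbalance_of_h_images (p' r' : List (Fin 2)) :
    (binomC (hWord p' ++ [0]) [0,1] : ℤ) - (binomC (hWord p' ++ [0]) [1,0] : ℤ) =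
      (p'.count 0 : ℤ) + 3 * (binomC p' [0,1] : ℤ) - 3 * (binomC p' [1,0] : ℤ) ∧
    (binomC ((1 : Fin 2) :: hWord r') [0,1] : ℤ)
        - (binomC ((1 : Fin 2) :: hWord r') [1,0] : ℤ) =
      (r'.count 1 : ℤ) + 3 * (binomC r' [0,1] : ℤ) - 3 * (binomC r' [1,0] : ℤ) := by
  constructor
  · rw [imbalance_hWord_append]
    simp [binomC_cons_cons, binomC_nil_cons]
    ring
  · have key := imbalance_hWord_append r' []
    simp [binomC_nil_cons] at key
    simp [binomC_cons_cons, binomC_singleton, count_zero_hWord]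
    linarith
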